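/- arXiv:1808.05725 — 4 statements merged into one kernel-verified Lean document; each statement's English description precedes it below -/
import Mathlib

section
/- Let θ ∈ (0,1) and let ε satisfy 0 < ε ≤ θ and θ + ε ≤ 1. Let A be a unital C*-algebra, let u, v be unitaries in A with u·v = e^{2πiθ}·v·u, and let τ be a tracial state on A such that τ(uⁿ) = 0 for every integer n ≠ 0 and τ(a·v) = 0 and τ(a·v*) = 0 for every a in the closed *-subalgebra of A generated by u (these conditions hold for the canonical trace on the rotation algebra A_θ). Then τ(e^θ(u,v)) = θ. -/
open scoped Real

noncomputable section

/-- The 1-periodic function `f̂`: on `[0,1]` it is `t/ε` on `[0,ε]`, `1` on `[ε,θ]`,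
`(θ+ε-t)/ε` on `[θ,θ+ε]`, and `0` on `[θ+ε,1]`. -/
def fhat (θ ε t : ℝ) : ℝ :=
  let s := Int.fract t
  if s ≤ ε then s / ε
  else if s ≤ θ then 1
  else if s ≤ θ + ε then (θ + ε - s) / ε
  else 0

/-- The 1-periodic function `ĝ`: on `[0,1]` it is `0` on `[0,θ]`,
`(f̂(t)(1-f̂(t)))^{1/2}` on `[θ,θ+ε]`, and `0` on `[θ+ε,1]`. -/
def ghat (θ ε t : ℝ) : ℝ :=
  let s := Int.fract t
  if s ≤ θ then 0
  else if s ≤ θ + ε then Real.sqrt (fhat θ ε t * (1 - fhat θ ε t))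
  else 0

/-- Lift a 1-periodic function `w : ℝ → ℝ` to the function on `ℂ` whose restriction to the
unit circle sends `e^{2πit}` to `w t`. -/
def liftCirc (w : ℝ → ℝ) (z : ℂ) : ℂ := (w (Complex.arg z / (2 * Real.pi)) : ℂ)

variable {A : Type*} [CStarAlgebra A]

/-- `f(u)`: continuous functional calculus of `f` applied to `u`. -/
def fCirc (θ ε : ℝ) (u : A) : A := cfc (liftCirc (fhat θ ε)) u

/-- `g(u)`: continuous functional calculus of `g` applied to `u`. -/
def gCirc (θ ε : ℝ) (u : A) : A := cfc (liftCirc (ghat θ ε)) u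

/-- The element `e^θ(u,v) = g(u)v* + f(u) + v g(u)`. -/
def eTheta (θ ε : ℝ) (u v : A) : A :=
  gCirc θ ε u * star v + fCirc θ ε u + v * gCirc θ ε u

/-- A tracial state on a unital complex C*-algebra: a continuous linear functional `τ` with
`τ 1 = 1`, `τ (a* a)` a nonnegative real for every `a`, and `τ (a b) = τ (b a)`. -/
def IsTracialState {A : Type*} [NormedRing A] [StarRing A] [NormedAlgebra ℂ A]
    (τ : A →L[ℂ] ℂ) : Prop :=
  τ 1 = 1 ∧ (∀ a : A, 0 ≤ (τ (star a * a)).re ∧ (τ (star a * a)).im = 0) ∧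
    ∀ a b : A, τ (a * b) = τ (b * a)

/-- Non-periodic profile of `fhat`. -/
def pHat (θ ε s : ℝ) : ℝ := max 0 (min 1 (min (s / ε) ((θ + ε - s) / ε)))

theorem pHat_continuous (θ ε : ℝ) : Continuous (pHat θ ε) := by
  unfold pHat
  fun_prop

theorem fhat_eq_pHat_fract (θ ε : ℝ) (hε : 0 < ε) (hεθ : ε ≤ θ) (t : ℝ) :
    fhat θ ε t = pHat θ ε (Int.fract t) := by
  have h0 := Int.fract_nonneg t
  unfold fhat pHat
  simp only
  generalize Int.fract t = s at *
  split_ifs with h1 h2 h3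
  · have a1 : s / ε ≤ 1 := by rw [div_le_one hε]; exact h1
    have a2 : s / ε ≤ (θ + ε - s) / ε := by gcongr; linarith
    have a3 : 0 ≤ s / ε := by positivity
    rw [min_eq_left a2, min_eq_right a1, max_eq_right a3]
  · have a1 : 1 ≤ s / ε := by rw [one_le_div hε]; linarith
    have a2 : 1 ≤ (θ + ε - s) / ε := by rw [one_le_div hε]; linarith
    rw [min_eq_left (le_min a1 a2), max_eq_right zero_le_one]
  · have a1 : (θ + ε - s) / ε ≤ 1 := by rw [div_le_one hε]; linarith
    have a2 : (θ + ε - s) / ε ≤ s / ε := by gcongr; linarith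
    have a3 : 0 ≤ (θ + ε - s) / ε := div_nonneg (by linarith) hε.le
    rw [min_eq_right a2, min_eq_right a1, max_eq_right a3]
  · have a1 : (θ + ε - s) / ε ≤ 0 := div_nonpos_of_nonpos_of_nonneg (by linarith) hε.le
    rw [max_eq_left ((min_le_right _ _).trans ((min_le_right _ _).trans a1))]

theorem pHat_zero (θ ε : ℝ) : pHat θ ε 0 = 0 := by
  unfold pHat
  rw [max_eq_left]
  exact (min_le_right _ _).trans ((min_le_left _ _).trans (by simp))

theorem pHat_one (θ ε : ℝ) (hε : 0 < ε) (hθε : θ + ε ≤ 1) : pHat θ ε 1 = 0 := by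
  unfold pHat
  rw [max_eq_left]
  exact (min_le_right _ _).trans ((min_le_right _ _).trans
    (div_nonpos_of_nonpos_of_nonneg (by linarith) hε.le))

theorem fhat_continuous (θ ε : ℝ) (hε : 0 < ε) (hεθ : ε ≤ θ) (hθε : θ + ε ≤ 1) :
    Continuous (fhat θ ε) := by
  have h : fhat θ ε = pHat θ ε ∘ Int.fract := funext (fhat_eq_pHat_fract θ ε hε hεθ)
  rw [h]
  apply ContinuousOn.comp_fract'' (pHat_continuous θ ε).continuousOn
  rw [pHat_zero, pHat_one θ ε hε hθε]

theorem fhat_periodic (θ ε : ℝ) : Function.Periodic (fhat θ ε) 1 := by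
  intro t
  unfold fhat
  rw [Int.fract_add_one]

theorem fhat_eq_pHat (θ ε : ℝ) (hε : 0 < ε) (hεθ : ε ≤ θ) (hθε : θ + ε ≤ 1) (t : ℝ)
    (h0 : 0 ≤ t) (h1 : t ≤ 1) : fhat θ ε t = pHat θ ε t := by
  rw [fhat_eq_pHat_fract θ ε hε hεθ]
  rcases h1.lt_or_eq with h | h
  · rw [Int.fract_eq_self.2 ⟨h0, h⟩]
  · rw [h, Int.fract_one, pHat_zero, pHat_one θ ε hε hθε]

theorem integral_fhat (θ ε : ℝ) (hε : 0 < ε) (hεθ : ε ≤ θ) (hθε : θ + ε ≤ 1) :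
    ∫ t in (0 : ℝ)..1, fhat θ ε t = θ := by
  have hc := pHat_continuous θ ε
  have e0 : ∫ t in (0 : ℝ)..1, fhat θ ε t = ∫ t in (0 : ℝ)..1, pHat θ ε t := by
    apply intervalIntegral.integral_congr
    intro t ht
    rw [Set.uIcc_of_le zero_le_one] at ht
    exact fhat_eq_pHat θ ε hε hεθ hθε t ht.1 ht.2
  have e1 : ∫ t in (0 : ℝ)..ε, pHat θ ε t = ∫ t in (0 : ℝ)..ε, t / ε := by
    apply intervalIntegral.integral_congr
    intro t ht
    rw [Set.uIcc_of_le hε.le] at ht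
    obtain ⟨l, r⟩ := ht
    have a1 : t / ε ≤ 1 := by rw [div_le_one hε]; exact r
    have a2 : t / ε ≤ (θ + ε - t) / ε := by gcongr; linarith
    have a3 : 0 ≤ t / ε := by positivity
    simp only [pHat]
    rw [min_eq_left a2, min_eq_right a1, max_eq_right a3]
  have e2 : ∫ t in ε..θ, pHat θ ε t = ∫ t in ε..θ, (1 : ℝ) := by
    apply intervalIntegral.integral_congr
    intro t ht
    rw [Set.uIcc_of_le hεθ] at ht
    obtain ⟨l, r⟩ := ht
    have a1 : 1 ≤ t / ε := by rw [one_le_div hε]; linarith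
    have a2 : 1 ≤ (θ + ε - t) / ε := by rw [one_le_div hε]; linarith
    simp only [pHat]
    rw [min_eq_left (le_min a1 a2), max_eq_right zero_le_one]
  have e3 : ∫ t in θ..(θ + ε), pHat θ ε t = ∫ t in θ..(θ + ε), (θ + ε - t) / ε := by
    apply intervalIntegral.integral_congr
    intro t ht
    rw [Set.uIcc_of_le (by linarith)] at ht
    obtain ⟨l, r⟩ := ht
    have a1 : (θ + ε - t) / ε ≤ 1 := by rw [div_le_one hε]; linarith
    have a2 : (θ + ε - t) / ε ≤ t / ε := by gcongr; linarith
    have a3 : 0 ≤ (θ + ε - t) / ε := div_nonneg (by linarith) hε.le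
    simp only [pHat]
    rw [min_eq_right a2, min_eq_right a1, max_eq_right a3]
  have e4 : ∫ t in (θ + ε)..1, pHat θ ε t = ∫ t in (θ + ε)..1, (0 : ℝ) := by
    apply intervalIntegral.integral_congr
    intro t ht
    rw [Set.uIcc_of_le hθε] at ht
    obtain ⟨l, r⟩ := ht
    have a1 : (θ + ε - t) / ε ≤ 0 := div_nonpos_of_nonpos_of_nonneg (by linarith) hε.le
    simp only [pHat]
    rw [max_eq_left ((min_le_right _ _).trans ((min_le_right _ _).trans a1))]
  have i (a b : ℝ) := hc.intervalIntegrable (μ := MeasureTheory.volume) a b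
  rw [e0, ← intervalIntegral.integral_add_adjacent_intervals (i 0 ε) (i ε 1),
    ← intervalIntegral.integral_add_adjacent_intervals (i ε θ) (i θ 1),
    ← intervalIntegral.integral_add_adjacent_intervals (i θ (θ + ε)) (i (θ + ε) 1), e1, e2, e3, e4,
    intervalIntegral.integral_div, intervalIntegral.integral_div,
    intervalIntegral.integral_sub (by simp) (by simp)]
  simp
  field_simp
  ring

/-- `fhat` as a continuous function on the additive circle. -/
def fAdd (θ ε : ℝ) (hε : 0 < ε) (hεθ : ε ≤ θ) (hθε : θ + ε ≤ 1) : C(AddCircle (1 : ℝ), ℂ) where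
  toFun x := (((fhat_periodic θ ε).lift x : ℝ) : ℂ)
  continuous_toFun := by
    refine Complex.continuous_ofReal.comp ?_
    exact continuous_coinduced_dom.mpr (fhat_continuous θ ε hε hεθ hθε)

theorem integral_fAdd (θ ε : ℝ) (hε : 0 < ε) (hεθ : ε ≤ θ) (hθε : θ + ε ≤ 1) :
    ∫ x, fAdd θ ε hε hεθ hθε x = (θ : ℂ) := by
  rw [← AddCircle.intervalIntegral_preimage 1 0, zero_add]
  have : ∀ t : ℝ, fAdd θ ε hε hεθ hθε (t : AddCircle (1 : ℝ)) = ((fhat θ ε t : ℝ) : ℂ) :=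
    fun t => rfl
  simp_rw [this]
  rw [intervalIntegral.integral_ofReal, integral_fhat θ ε hε hεθ hθε]

theorem integral_fourier_one (n : ℤ) (hn : n ≠ 0) :
    ∫ x : AddCircle (1 : ℝ), fourier n x = 0 := by
  exact MeasureTheory.integral_eq_zero_of_add_right_eq_neg
      (fourier_add_half_inv_index hn one_pos)

/-- A linear functional on continuous functions on the circle which vanishes on nontrivial
characters and is normalized is the Haar integral. -/
theorem functional_eq_integral (Φ : C(AddCircle (1 : ℝ), ℂ) →L[ℂ] ℂ) (h1 : Φ 1 = 1)
    (hn : ∀ n : ℤ, n ≠ 0 → Φ (fourier n) = 0) (h : C(AddCircle (1 : ℝ), ℂ)) :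
    Φ h = ∫ x, h x := by
  have hint : ∀ k : C(AddCircle (1 : ℝ), ℂ), MeasureTheory.Integrable k :=
    fun k => k.continuous.integrable_of_hasCompactSupport (HasCompactSupport.of_compactSpace _)
  let Ψ : C(AddCircle (1 : ℝ), ℂ) →L[ℂ] ℂ := LinearMap.mkContinuous
    { toFun := fun k => ∫ x, k x
      map_add' := fun a b => MeasureTheory.integral_add (hint a) (hint b)
      map_smul' := fun c a => MeasureTheory.integral_smul c a } 1 (by
      intro k
      have := MeasureTheory.norm_integral_le_of_norm_le_const
        (μ := (MeasureTheory.volume : MeasureTheory.Measure (AddCircle (1 : ℝ))))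
        (Filter.Eventually.of_forall fun x => k.norm_coe_le_norm x)
      simpa [MeasureTheory.measureReal_def] using this)
  have key : Φ = Ψ := by
    apply ContinuousLinearMap.ext_on (s := Set.range (fourier (T := 1)))
    · rw [dense_iff_closure_eq, ← Submodule.topologicalClosure_coe, span_fourier_closure_eq_top]
      rfl
    · rintro _ ⟨n, rfl⟩
      by_cases h0 : n = 0
      · subst h0
        have e : (fourier 0 : C(AddCircle (1 : ℝ), ℂ)) = 1 := by ext x; exact fourier_zero
        rw [e, h1]
        change 1 = ∫ x : AddCircle (1 : ℝ), (1 : ℂ)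
        simp [MeasureTheory.measureReal_def]
      · rw [hn n h0]
        exact (integral_fourier_one n h0).symm
  rw [key]
  rfl

/-- The logarithm map from the spectrum of a unitary to the additive circle. -/
def specLog (u : A) (hu : u ∈ unitary A) : C(spectrum ℂ u, AddCircle (1 : ℝ)) where
  toFun x := (AddCircle.homeomorphCircle (T := 1) one_ne_zero).symm
    ⟨x.1, Unitary.spectrum_subset_circle (𝕜 := ℂ) ⟨u, hu⟩ x.2⟩
  continuous_toFun := by
    refine (Homeomorph.continuous _).comp ?_
    exact continuous_subtype_val.subtype_mk _

theorem toCircle_specLog (u : A) (hu : u ∈ unitary A) (x : spectrum ℂ u) :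
    ((AddCircle.toCircle (specLog u hu x) : Circle) : ℂ) = x.1 := by
  rw [← AddCircle.homeomorphCircle_apply one_ne_zero]
  exact congrArg Subtype.val ((AddCircle.homeomorphCircle (T := 1) one_ne_zero).apply_symm_apply _)

theorem specLog_eq (u : A) (hu : u ∈ unitary A) (x : spectrum ℂ u) :
    specLog u hu x = ((Complex.arg x.1 / (2 * π) : ℝ) : AddCircle (1 : ℝ)) := by
  apply AddCircle.injective_toCircle one_ne_zero
  rw [AddCircle.toCircle_apply_mk]
  have e : 2 * π / 1 * (Complex.arg x.1 / (2 * π)) = Complex.arg x.1 := by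
    field_simp
  rw [e, ← toCircle_specLog u hu x, Circle.exp_arg]

theorem tau_fCirc (θ ε : ℝ) (hε : 0 < ε) (hεθ : ε ≤ θ) (hθε : θ + ε ≤ 1)
    (u : A) (hu : u ∈ unitary A) (τ : A →L[ℂ] ℂ) (h1 : τ 1 = 1)
    (hpow : ∀ n : ℕ, n ≠ 0 → τ (u ^ n) = 0 ∧ τ ((star u) ^ n) = 0) :
    τ (fCirc θ ε u) = (θ : ℂ) := by
  have hn : IsStarNormal u := ⟨(Unitary.star_mul_self_of_mem hu).trans (Unitary.mul_star_self_of_mem hu).symm⟩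
  let π₀ : C(AddCircle (1 : ℝ), ℂ) →⋆ₐ[ℂ] A :=
    (cfcHom (R := ℂ) hn).comp (ContinuousMap.compStarAlgHom' ℂ ℂ (specLog u hu))
  have hπc : Continuous π₀ :=
    (cfcHom_continuous hn).comp (ContinuousMap.continuous_precomp _)
  let Φ : C(AddCircle (1 : ℝ), ℂ) →L[ℂ] ℂ :=
    τ.comp ⟨π₀.toAlgHom.toLinearMap, hπc⟩
  have hΦ : ∀ k, Φ k = τ (π₀ k) := fun k => rfl
  have hf1 : π₀ (fourier 1) = u := by
    have e : ContinuousMap.compStarAlgHom' ℂ ℂ (specLog u hu) (fourier 1)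
        = (ContinuousMap.id ℂ).restrict (spectrum ℂ u) := by
      ext x
      change fourier 1 (specLog u hu x) = x.1
      rw [fourier_one, toCircle_specLog]
    change cfcHom (R := ℂ) hn (ContinuousMap.compStarAlgHom' ℂ ℂ (specLog u hu) (fourier 1)) = u
    rw [e]
    exact cfcHom_id hn
  have hpos : ∀ n : ℕ, (fourier (n : ℤ) : C(AddCircle (1 : ℝ), ℂ)) = (fourier 1) ^ n := by
    intro n
    ext x
    simp [fourier_apply, AddCircle.toCircle_nsmul]
  have hneg : ∀ n : ℕ, (fourier (-(n : ℤ)) : C(AddCircle (1 : ℝ), ℂ)) = star (fourier 1 ^ n) := by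
    intro n
    rw [← hpos]
    ext x
    exact fourier_neg
  have main := functional_eq_integral Φ (by rw [hΦ, map_one, h1]) (by
    intro n hn0
    rw [hΦ]
    obtain ⟨m, rfl | rfl⟩ := n.eq_nat_or_neg
    · rw [hpos, map_pow, hf1]
      exact (hpow m (by simpa using hn0)).1
    · rw [hneg, map_star, map_pow, hf1, star_pow]
      exact (hpow m (by simpa using hn0)).2) (fAdd θ ε hε hεθ hθε)
  rw [integral_fAdd, hΦ] at main
  rw [← main]
  congr 1
  have hval : ∀ x : spectrum ℂ u,
      liftCirc (fhat θ ε) x.1 = fAdd θ ε hε hεθ hθε (specLog u hu x) := by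
    intro x
    rw [specLog_eq]
    rfl
  have hcont : ContinuousOn (liftCirc (fhat θ ε)) (spectrum ℂ u) := by
    rw [continuousOn_iff_continuous_domRestrict]
    have : (spectrum ℂ u).domRestrict (liftCirc (fhat θ ε))
        = fun x => fAdd θ ε hε hεθ hθε (specLog u hu x) := funext hval
    rw [this]
    exact (ContinuousMap.continuous _).comp (ContinuousMap.continuous _)
  rw [fCirc, cfc_apply _ u hn hcont]
  change cfcHom (R := ℂ) hn _ = cfcHom (R := ℂ) hn _
  congr 1
  ext x
  exact hval x

theorem stmt2 {A : Type*} [CStarAlgebra A] (θ ε : ℝ) (hθ : θ ∈ Set.Ioo (0 : ℝ) 1)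
    (hε : 0 < ε) (hεθ : ε ≤ θ) (hθε : θ + ε ≤ 1)
    (u v : A) (hu : u ∈ unitary A) (hv : v ∈ unitary A)
    (huv : u * v = Complex.exp (2 * π * Complex.I * θ) • (v * u))
    (τ : A →L[ℂ] ℂ) (hτ : IsTracialState τ)
    (hpow : ∀ n : ℕ, n ≠ 0 → τ (u ^ n) = 0 ∧ τ ((star u) ^ n) = 0)
    (hcoef : ∀ a ∈ (StarAlgebra.adjoin ℂ ({u} : Set A)).topologicalClosure,
      τ (a * v) = 0 ∧ τ (a * star v) = 0) :
    τ (eTheta θ ε u v) = (θ : ℂ) := by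
  have hg : gCirc θ ε u ∈ (StarAlgebra.adjoin ℂ ({u} : Set A)).topologicalClosure :=
    cfc_mem_elemental _ u
  obtain ⟨h1, h2⟩ := hcoef _ hg
  rw [eTheta, map_add, map_add, h2, hτ.2.2 v, h1,
    tau_fCirc θ ε hε hεθ hθε u hu τ hτ.1 hpow]
  simp
end
end

section
/- Let θ ∈ [0,1). There exists δ > 0 such that for every unital C*-algebra A admitting a tracial state, every tracial state τ on A, and all unitaries u, v, ũ, ṽ ∈ A satisfying (1) ‖u·v − e^{2πiθ}·v·u‖ < 2, (2) ũ·ṽ = e^{2πiθ}·ṽ·ũ, and (3) ‖ũ − u‖ < δ and ‖ṽ − v‖ < δ, one has (1/(2πi))·τ(log_θ(u v u* v*)) = θ. -/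
open scoped Real

noncomputable section

variable {A : Type*} [CStarAlgebra A]

/-- `log_α(w)`: the continuous branch of logarithm sending `e^{2πit}` to `2πit` for
`t ∈ (α - 1/2, α + 1/2)`, i.e. `z ↦ 2πiα + Log(e^{-2πiα} z)`, applied to `w` via the
continuous functional calculus. -/
def logU (α : ℝ) (w : A) : A :=
  cfc (fun z : ℂ =>
    2 * π * Complex.I * α + Complex.log (Complex.exp (-(2 * π * Complex.I * α)) * z)) w

/-- Power series for the trace of `log (1 + x)`. -/
def trLog {A : Type*} [CStarAlgebra A] (τ : A →L[ℂ] ℂ) (x : A) : ℂ :=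
  ∑' n : ℕ, ((-1 : ℂ) ^ n / (n + 1)) * τ (x ^ (n + 1))

lemma coeff_norm_le (n : ℕ) : ‖((-1 : ℂ) ^ n / (n + 1))‖ ≤ 1 := by
  have h : ‖((n : ℂ) + 1)‖ = (n : ℝ) + 1 := by
    rw [← Nat.cast_succ, Complex.norm_natCast]; push_cast; rfl
  rw [norm_div, norm_pow, norm_neg, norm_one, one_pow, h]
  rw [div_le_one (by positivity)]
  have : (0 : ℝ) ≤ n := Nat.cast_nonneg n
  linarith

lemma summable_trLog {A : Type*} [CStarAlgebra A] [Nontrivial A] (τ : A →L[ℂ] ℂ) (x : A)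
    (hx : ‖x‖ < 1) : Summable fun n : ℕ => ((-1 : ℂ) ^ n / (n + 1)) * τ (x ^ (n + 1)) := by
  refine Summable.of_norm_bounded (g := fun n => ‖τ‖ * (‖x‖ ^ n * ‖x‖))
    (((summable_geometric_of_lt_one (norm_nonneg _) hx).mul_right _).mul_left _) fun n => ?_
  calc _ ≤ 1 * (‖τ‖ * ‖x ^ (n + 1)‖) := by
        rw [norm_mul]
        exact mul_le_mul (coeff_norm_le n) (τ.le_opNorm _) (norm_nonneg _) zero_le_one
    _ ≤ _ := by
        rw [one_mul, ← pow_succ]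
        gcongr
        exact norm_pow_le _ _

lemma trace_pow_deriv {A : Type*} [CStarAlgebra A] (τ : A →L[ℂ] ℂ)
    (htr : ∀ a b : A, τ (a * b) = τ (b * a)) (a b : A) (n : ℕ) (t : ℂ) :
    HasDerivAt (fun t : ℂ => ((-1 : ℂ) ^ n / (n + 1)) * τ ((a + t • b) ^ (n + 1)))
      (τ ((-(a + t • b)) ^ n * b)) t := by
  have h1 : HasDerivAt (fun t : ℂ => a + t • b) b t := by
    simpa using ((hasDerivAt_id t).smul_const b).const_add a
  have h2 := (τ.hasFDerivAt.comp_hasDerivAt t (h1.fun_pow' (n + 1))).const_mul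
    ((-1 : ℂ) ^ n / (n + 1))
  refine h2.congr_deriv ?_
  symm
  rw [map_sum]
  have : ∀ i ∈ Finset.range (n + 1),
      τ ((a + t • b) ^ ((n + 1).pred - i) * b * (a + t • b) ^ i) = τ ((a + t • b) ^ n * b) := by
    intro i hi
    have hi' : i ≤ n := by simpa [Nat.lt_succ_iff] using hi
    rw [htr, ← mul_assoc, ← pow_add]
    congr 3
    simp only [Nat.pred_succ]; omega
  rw [Finset.sum_congr rfl this, Finset.sum_const, Finset.card_range, nsmul_eq_mul, neg_pow]
  have hn : ((n : ℂ) + 1) ≠ 0 := Nat.cast_add_one_ne_zero n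
  have : ((-1 : A) ^ n * (a + t • b) ^ n * b) = ((-1 : ℂ) ^ n) • ((a + t • b) ^ n * b) := by
    rcases neg_one_pow_eq_or ℤ n with h | h <;>
    · have h3 : (-1 : A) ^ n = ((-1 : ℤ) ^ n : ℤ) := by push_cast; rfl
      have h4 : (-1 : ℂ) ^ n = ((-1 : ℤ) ^ n : ℤ) := by push_cast; rfl
      rw [h3, h4, h]; simp
  rw [this, map_smul, smul_eq_mul]
  push_cast
  field_simp

lemma trLog_deriv {A : Type*} [CStarAlgebra A] [Nontrivial A] (τ : A →L[ℂ] ℂ)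
    (htr : ∀ a b : A, τ (a * b) = τ (b * a)) (a b : A) (hab : ‖a‖ + 2 * ‖b‖ < 1)
    (t : ℂ) (ht : t ∈ Metric.ball (0 : ℂ) 2) :
    HasDerivAt (fun t : ℂ => trLog τ (a + t • b)) (τ (Ring.inverse (1 + (a + t • b)) * b)) t := by
  set r := ‖a‖ + 2 * ‖b‖
  have hr0 : 0 ≤ r := by positivity
  have hz : ∀ t ∈ Metric.ball (0 : ℂ) 2, ‖a + t • b‖ ≤ r := by
    intro t ht
    rw [mem_ball_zero_iff] at ht
    calc _ ≤ ‖a‖ + ‖t‖ * ‖b‖ := (norm_add_le _ _).trans (by rw [norm_smul])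
      _ ≤ _ := by simp only [r]; gcongr
  have key := hasDerivAt_tsum_of_isPreconnected (𝕜 := ℂ) (u := fun n => ‖τ‖ * (r ^ n * ‖b‖))
    (((summable_geometric_of_lt_one hr0 hab).mul_right _).mul_left _)
    (Metric.isOpen_ball (x := (0 : ℂ)) (ε := 2)) (convex_ball _ _).isPreconnected
    (fun n y _ => trace_pow_deriv τ htr a b n y)
    (fun n y hy => by
      refine (τ.le_opNorm _).trans ?_
      gcongr
      refine (norm_mul_le _ _).trans ?_
      gcongr
      refine (norm_pow_le _ _).trans ?_
      rw [norm_neg]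
      gcongr
      exact hz y hy)
    ht (summable_trLog τ _ ((hz t ht).trans_lt hab)) ht
  unfold trLog
  refine key.congr_deriv ?_
  have hs := hasSum_geom_series_inverse (-(a + t • b)) (by rw [norm_neg]; exact (hz t ht).trans_lt hab)
  rw [sub_neg_eq_add] at hs
  exact (τ.hasSum (hs.mul_right b)).tsum_eq

lemma trLog_zero {A : Type*} [CStarAlgebra A] (τ : A →L[ℂ] ℂ) : trLog τ 0 = 0 := by
  simp [trLog]

lemma trLog_mul {A : Type*} [CStarAlgebra A] [Nontrivial A] (τ : A →L[ℂ] ℂ)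
    (htr : ∀ a b : A, τ (a * b) = τ (b * a)) (x y : A) (hx : ‖x‖ ≤ 1 / 20) (hy : ‖y‖ ≤ 1 / 5) :
    trLog τ ((1 + x) * (1 + y) - 1) = trLog τ x + trLog τ y := by
  have hw : ‖x * (1 + y)‖ ≤ 1 / 20 * (6 / 5) := by
    refine (norm_mul_le _ _).trans ?_
    gcongr
    refine (norm_add_le _ _).trans ?_
    rw [norm_one]; linarith
  have h1 := trLog_deriv τ htr y (x * (1 + y)) (by linarith)
  have h2 := trLog_deriv τ htr 0 x (by rw [norm_zero]; linarith)
  have hyu : IsUnit (1 + y) := by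
    have := (Units.oneSub (-y) (by rw [norm_neg]; linarith)).isUnit
    simpa using this
  obtain ⟨Y, hY⟩ := hyu
  have heq : Set.EqOn (fun t : ℂ => trLog τ (y + t • (x * (1 + y))))
      (fun t : ℂ => trLog τ (0 + t • x) + trLog τ y) (Metric.ball (0 : ℂ) 2) := by
    refine IsOpen.eqOn_of_deriv_eq Metric.isOpen_ball (convex_ball _ _).isPreconnected
      (fun t ht => (h1 t ht).differentiableAt.differentiableWithinAt)
      (fun t ht => ((h2 t ht).add_const _).differentiableAt.differentiableWithinAt) ?_
      (x := 0) (by simp) ?_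
    · intro t ht
      rw [(h1 t ht).deriv, ((h2 t ht).add_const _).deriv]
      have hxu : IsUnit (1 + t • x) := by
        have ht' := mem_ball_zero_iff.1 ht
        have := (Units.oneSub (-(t • x)) (by
          rw [norm_neg, norm_smul]
          nlinarith [norm_nonneg t, norm_nonneg x])).isUnit
        simpa using this
      obtain ⟨X, hX⟩ := hxu
      have e : 1 + (y + t • (x * (1 + y))) = ((X * Y : Aˣ) : A) := by
        rw [Units.val_mul, hX, hY, add_mul, one_mul, smul_mul_assoc, add_assoc]
      rw [e, zero_add, ← hX, Ring.inverse_unit, Ring.inverse_unit, ← hY, mul_inv_rev, Units.val_mul,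
        mul_assoc, htr, mul_assoc, mul_assoc, Units.mul_inv, mul_one]
    · simp [trLog_zero]
  have := heq (show (1 : ℂ) ∈ Metric.ball (0 : ℂ) 2 by simp)
  simp only [one_smul, zero_add] at this
  rw [← this]
  congr 1
  noncomm_ring

lemma trLog_conj {A : Type*} [CStarAlgebra A] (τ : A →L[ℂ] ℂ)
    (htr : ∀ a b : A, τ (a * b) = τ (b * a)) (x w : A) (hw : w ∈ unitary A) :
    trLog τ (w * x * star w) = trLog τ x := by
  have h : ∀ n : ℕ, (w * x * star w) ^ n = w * x ^ n * star w := by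
    intro n
    induction n with
    | zero => simp [Unitary.mul_star_self_of_mem hw]
    | succ n ih =>
      rw [pow_succ, ih, pow_succ]
      have : w * x ^ n * star w * (w * x * star w) = w * x ^ n * (star w * w) * x * star w := by
        noncomm_ring
      rw [this, Unitary.star_mul_self_of_mem hw]; noncomm_ring
  unfold trLog
  congr 1; ext n
  rw [h, htr, ← mul_assoc, Unitary.star_mul_self_of_mem hw, one_mul]

lemma tr_logU {A : Type*} [CStarAlgebra A] [Nontrivial A] (τ : A →L[ℂ] ℂ) (h1 : τ 1 = 1) (θ : ℝ)
    (w : A) (hw : w ∈ unitary A)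
    (hn : ‖Complex.exp (-(2 * π * Complex.I * θ)) • w - 1‖ < 1) :
    τ (logU θ w) = 2 * π * Complex.I * θ +
      trLog τ (Complex.exp (-(2 * π * Complex.I * θ)) • w - 1) := by
  have hN : IsStarNormal w := isStarNormal_of_mem_unitary hw
  set c := Complex.exp (-(2 * π * Complex.I * θ))
  set k : ℂ := 2 * π * Complex.I * θ
  set r := ‖c • w - 1‖
  have hcfc : cfc (fun z : ℂ => c * z - 1) w = c • w - 1 := by
    rw [cfc_sub .., cfc_const_mul .., cfc_id' .., cfc_const_one ..]
  have hsp : ∀ z ∈ spectrum ℂ w, ‖c * z - 1‖ ≤ r := by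
    intro z hz
    have := norm_apply_le_norm_cfc (fun z : ℂ => c * z - 1) w hz
    rwa [hcfc] at this
  have hunif : TendstoUniformlyOn
      (fun N : ℕ => fun z : ℂ => ∑ n ∈ Finset.range N, ((-1 : ℂ) ^ n / (n + 1)) * (c * z - 1) ^ (n + 1))
      (fun z => ∑' n : ℕ, ((-1 : ℂ) ^ n / (n + 1)) * (c * z - 1) ^ (n + 1)) Filter.atTop
      (spectrum ℂ w) := by
    refine tendstoUniformlyOn_tsum_nat (u := fun n => r ^ n * r)
      ((summable_geometric_of_lt_one (norm_nonneg _) hn).mul_right _) fun n z hz => ?_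
    rw [norm_mul, norm_pow, ← pow_succ, ← one_mul (r ^ (n + 1))]
    gcongr
    · exact coeff_norm_le n
    · exact hsp z hz
  have hlog : Set.EqOn (fun z => ∑' n : ℕ, ((-1 : ℂ) ^ n / (n + 1)) * (c * z - 1) ^ (n + 1))
      (fun z => Complex.log (c * z)) (spectrum ℂ w) := by
    intro z hz
    have h := Complex.hasSum_taylorSeries_log ((hsp z hz).trans_lt hn)
    rw [← hasSum_nat_add_iff' 1] at h
    simp only [Finset.range_one, Finset.sum_singleton, Nat.cast_zero, div_zero, sub_zero,
      add_sub_cancel] at h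
    refine Eq.trans ?_ h.tsum_eq
    refine tsum_congr fun n => ?_
    push_cast
    ring
  have hunif' := hunif.congr_right hlog
  have hcont : ContinuousOn (fun z => Complex.log (c * z)) (spectrum ℂ w) :=
    hunif'.continuousOn (Filter.Frequently.of_forall fun N => by fun_prop)
  have hT := tendsto_cfc_fun (a := w) hunif' (Filter.Eventually.of_forall fun N => by fun_prop)
  have hpoly : ∀ N : ℕ, cfc (fun z : ℂ => ∑ n ∈ Finset.range N,
      ((-1 : ℂ) ^ n / (n + 1)) * (c * z - 1) ^ (n + 1)) w =
      ∑ n ∈ Finset.range N, ((-1 : ℂ) ^ n / (n + 1)) • (c • w - 1) ^ (n + 1) := by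
    intro N
    have := cfc_sum (R := ℂ) (fun (n : ℕ) (z : ℂ) => ((-1 : ℂ) ^ n / (n + 1)) * (c * z - 1) ^ (n + 1)) w
      (Finset.range N) (fun i _ => by fun_prop)
    rw [show (fun z : ℂ => ∑ n ∈ Finset.range N,
      ((-1 : ℂ) ^ n / (n + 1)) * (c * z - 1) ^ (n + 1)) = ∑ n ∈ Finset.range N,
      (fun (n : ℕ) (z : ℂ) => ((-1 : ℂ) ^ n / (n + 1)) * (c * z - 1) ^ (n + 1)) n by
        ext z; simp, this]
    refine Finset.sum_congr rfl fun n _ => ?_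
    rw [cfc_const_mul .., cfc_pow .., hcfc]
  simp only [hpoly] at hT
  have hT2 := (τ.continuous.tendsto _).comp hT
  have hS := (summable_trLog τ (c • w - 1) hn).hasSum.tendsto_sum_nat
  have hfin : τ (cfc (fun z => Complex.log (c * z)) w) = trLog τ (c • w - 1) := by
    refine tendsto_nhds_unique hT2 ?_
    refine hS.congr fun N => ?_
    simp [map_sum]
  unfold logU
  change τ (cfc (fun z => k + Complex.log (c * z)) w) = _
  rw [cfc_const_add k _ w hcont, map_add, hfin, Algebra.algebraMap_eq_smul_one, map_smul, h1,
    smul_eq_mul, mul_one]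

lemma norm_mul_sub_one_le {A : Type*} [CStarAlgebra A] (p q : A) (a b : ℝ) (hp : ‖p - 1‖ ≤ a)
    (hq : ‖q - 1‖ ≤ b) : ‖p * q - 1‖ ≤ a * b + a + b := by
  have : p * q - 1 = (p - 1) * (q - 1) + (p - 1) + (q - 1) := by noncomm_ring
  rw [this]
  refine (norm_add₃_le).trans ?_
  gcongr
  refine (norm_mul_le _ _).trans ?_
  have : 0 ≤ a := (norm_nonneg _).trans hp
  gcongr

lemma trLog_mul' {A : Type*} [CStarAlgebra A] [Nontrivial A] (τ : A →L[ℂ] ℂ)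
    (htr : ∀ a b : A, τ (a * b) = τ (b * a)) (p q : A) (hx : ‖p - 1‖ ≤ 1 / 20)
    (hy : ‖q - 1‖ ≤ 1 / 5) :
    trLog τ (p * q - 1) = trLog τ (p - 1) + trLog τ (q - 1) := by
  have := trLog_mul τ htr (p - 1) (q - 1) hx hy
  simpa using this

lemma norm_conj_sub_one {A : Type*} [CStarAlgebra A] (p w : A) (hw : w ∈ unitary A) :
    ‖w * p * star w - 1‖ = ‖p - 1‖ := by
  have : w * p * star w - 1 = w * (p - 1) * star w := by
    rw [mul_sub, sub_mul, mul_one, Unitary.mul_star_self_of_mem hw]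
  rw [this, CStarRing.norm_mul_mem_unitary _ (Unitary.star_mem hw), CStarRing.norm_mem_unitary_mul _ hw]

lemma trLog_conj' {A : Type*} [CStarAlgebra A] (τ : A →L[ℂ] ℂ)
    (htr : ∀ a b : A, τ (a * b) = τ (b * a)) (p w : A) (hw : w ∈ unitary A) :
    trLog τ (w * p * star w - 1) = trLog τ (p - 1) := by
  have : w * p * star w - 1 = w * (p - 1) * star w := by
    rw [mul_sub, sub_mul, mul_one, Unitary.mul_star_self_of_mem hw]
  rw [this, trLog_conj τ htr _ _ hw]

lemma trLog_star {A : Type*} [CStarAlgebra A] [Nontrivial A] (τ : A →L[ℂ] ℂ)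
    (htr : ∀ a b : A, τ (a * b) = τ (b * a)) (p : A) (hp : p ∈ unitary A)
    (hx : ‖p - 1‖ ≤ 1 / 20) :
    trLog τ (star p - 1) = - trLog τ (p - 1) := by
  have h : ‖star p - 1‖ = ‖p - 1‖ := by
    rw [← norm_star (p - 1), star_sub, star_one]
  have := trLog_mul' τ htr p (star p) hx (by rw [h]; linarith)
  rw [Unitary.mul_star_self_of_mem hp, sub_self, trLog_zero] at this
  linear_combination -this

theorem stmt5 (θ : ℝ) (hθ : θ ∈ Set.Ico (0 : ℝ) 1) :
    ∃ δ > (0 : ℝ), ∀ (A : Type*) [CStarAlgebra A] (τ : A →L[ℂ] ℂ), IsTracialState τ →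
      ∀ u v u' v' : A, u ∈ unitary A → v ∈ unitary A → u' ∈ unitary A → v' ∈ unitary A →
      ‖u * v - Complex.exp (2 * π * Complex.I * θ) • (v * u)‖ < 2 →
      u' * v' = Complex.exp (2 * π * Complex.I * θ) • (v' * u') →
      ‖u' - u‖ < δ → ‖v' - v‖ < δ →
      (1 / (2 * π * Complex.I)) * τ (logU θ (u * v * star u * star v)) = (θ : ℂ) := by
  refine ⟨1 / 20, by norm_num, ?_⟩
  intro A _ τ hτ u v u' v' hu hv hu' hv' _ hcomm hnu hnv
  obtain ⟨h1, -, htr⟩ := hτ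
  have : Nontrivial A := by
    refine ⟨⟨0, 1, fun h => ?_⟩⟩
    rw [← h, map_zero] at h1
    exact zero_ne_one h1
  have hsu' := Unitary.star_mem hu'
  have hsv' := Unitary.star_mem hv'
  obtain ⟨p, hp⟩ : ∃ p, p = star u' * u := ⟨_, rfl⟩
  obtain ⟨q, hq⟩ : ∃ q, q = star v' * v := ⟨_, rfl⟩
  have hpU : p ∈ unitary A := hp ▸ mul_mem hsu' hu
  have hqU : q ∈ unitary A := hq ▸ mul_mem hsv' hv
  have hup : u = u' * p := by rw [hp, ← mul_assoc, Unitary.mul_star_self_of_mem hu', one_mul]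
  have hvq : v = v' * q := by rw [hq, ← mul_assoc, Unitary.mul_star_self_of_mem hv', one_mul]
  have hpn : ‖p - 1‖ ≤ 1 / 20 := by
    have : p - 1 = star u' * (u - u') := by
      rw [hp, mul_sub, Unitary.star_mul_self_of_mem hu']
    rw [this, CStarRing.norm_mem_unitary_mul _ hsu', norm_sub_rev]
    exact hnu.le
  have hqn : ‖q - 1‖ ≤ 1 / 20 := by
    have : q - 1 = star v' * (v - v') := by
      rw [hq, mul_sub, Unitary.star_mul_self_of_mem hv']
    rw [this, CStarRing.norm_mem_unitary_mul _ hsv', norm_sub_rev]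
    exact hnv.le
  have hstar : ∀ p : A, ‖star p - 1‖ = ‖p - 1‖ := fun p => by
    rw [← norm_star (p - 1), star_sub, star_one]
  obtain ⟨P, hP⟩ : ∃ P, P = star v' * p * star (star v') := ⟨_, rfl⟩
  obtain ⟨Q, hQ⟩ : ∃ Q, Q = star u' * star q * star (star u') := ⟨_, rfl⟩
  have hPn : ‖P - 1‖ ≤ 1 / 20 := by rw [hP, norm_conj_sub_one _ _ hsv']; exact hpn
  have hQn : ‖Q - 1‖ ≤ 1 / 20 := by rw [hQ, norm_conj_sub_one _ _ hsu', hstar]; exact hqn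
  have hn1 : ‖star p * Q - 1‖ ≤ 1 / 9 :=
    (norm_mul_sub_one_le _ _ _ _ ((hstar p).trans_le hpn) hQn).trans (by norm_num)
  have hn2 : ‖q * (star p * Q) - 1‖ ≤ 1 / 5 :=
    (norm_mul_sub_one_le _ _ _ _ hqn hn1).trans (by norm_num)
  have hn3 : ‖P * (q * (star p * Q)) - 1‖ ≤ 1 / 2 :=
    (norm_mul_sub_one_le _ _ _ _ hPn hn2).trans (by norm_num)
  have htl : trLog τ (P * (q * (star p * Q)) - 1) = 0 := by
    rw [trLog_mul' τ htr _ _ hPn hn2, trLog_mul' τ htr _ _ hqn (hn1.trans (by norm_num)),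
      trLog_mul' τ htr _ _ ((hstar p).trans_le hpn) (hQn.trans (by norm_num)), hP, hQ,
      trLog_conj' τ htr _ _ hsv', trLog_conj' τ htr _ _ hsu', trLog_star τ htr p hpU hpn,
      trLog_star τ htr q hqU hqn]
    ring
  have hW : Complex.exp (-(2 * π * Complex.I * θ)) • (u * v * star u * star v) =
      (u' * v') * (P * (q * (star p * Q))) * star (u' * v') := by
    have e1 : star (u' * v') = Complex.exp (-(2 * π * Complex.I * θ)) • (star u' * star v') := by
      rw [hcomm, star_smul, star_mul]
      congr 1
      rw [Complex.star_def, ← Complex.exp_conj]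
      have h2 : (starRingEnd ℂ) 2 = 2 := Complex.conj_ofNat 2
      simp [h2]
    rw [e1, mul_smul_comm]
    congr 1
    rw [hP, hQ, hup, hvq]
    simp only [star_star, star_mul]
    have a1 : ∀ x : A, v' * (star v' * x) = x := fun x => by
      rw [← mul_assoc, Unitary.mul_star_self_of_mem hv', one_mul]
    have a2 : ∀ x : A, u' * (star u' * x) = x := fun x => by
      rw [← mul_assoc, Unitary.mul_star_self_of_mem hu', one_mul]
    simp only [mul_assoc, a1, a2]
  have hW2 : u * v * star u * star v ∈ unitary A :=
    mul_mem (mul_mem (mul_mem hu hv) (Unitary.star_mem hu)) (Unitary.star_mem hv)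
  have huv := mul_mem hu' hv'
  rw [tr_logU τ h1 θ _ hW2 (by rw [hW, norm_conj_sub_one _ _ huv]; linarith), hW,
    trLog_conj' τ htr _ _ huv, htl, add_zero]
  have : (π : ℂ) ≠ 0 := by exact_mod_cast Real.pi_ne_zero
  have := Complex.I_ne_zero
  field_simp
end
end

section
/- Let n ≥ 1 and let θ_{j,k} ∈ [0,1) be given real numbers for 1 ≤ j,k ≤ n. There exist δ > 0 and θ ∈ [0,1) such that for every unital C*-algebra A and all unitaries v₁, …, vₙ ∈ A satisfying ‖v_k v_j − e^{2πi θ_{j,k}} v_j v_k‖ < δ for all 1 ≤ j,k ≤ n, the following hold for all j,k: the point −e^{2πiθ} is not in the spectrum of v_k v_j v_k* v_j*, the point −e^{2πiθ_{j,k}} is not in the spectrum of v_k v_j v_k* v_j*, and log_θ(v_k v_j v_k* v_j*) = log_{θ_{j,k}}(v_k v_j v_k* v_j*). -/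
open scoped Real

noncomputable section

variable {A : Type*} [CStarAlgebra A]

theorem aux_log (θ t ε : ℝ) (h : |2 * π * (t - θ)| + ε ≤ π) (u z : ℂ) (hu : u ≠ 0)
    (hl : ‖Complex.log u‖ < ε) (hz : z = Complex.exp (2 * π * Complex.I * t) * u) :
    Complex.log (Complex.exp (-(2 * π * Complex.I * θ)) * z)
      = 2 * π * Complex.I * t - 2 * π * Complex.I * θ + Complex.log u ∧
    z ≠ -Complex.exp (2 * π * Complex.I * θ) := by
  have him : (2 * π * Complex.I * t - 2 * π * Complex.I * θ + Complex.log u).im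
      = 2 * π * (t - θ) + (Complex.log u).im := by
    simp; ring
  have h1 := Complex.abs_im_le_norm (Complex.log u)
  have h2 := abs_add_le (2 * π * (t - θ)) (Complex.log u).im
  have h3 : |2 * π * (t - θ) + (Complex.log u).im| < π := by linarith
  have h4 := abs_lt.1 h3
  have key : Complex.log (Complex.exp (-(2 * π * Complex.I * θ)) * z)
      = 2 * π * Complex.I * t - 2 * π * Complex.I * θ + Complex.log u := by
    have e : Complex.exp (-(2 * π * Complex.I * θ)) * z =
        Complex.exp (2 * π * Complex.I * t - 2 * π * Complex.I * θ + Complex.log u) := by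
      rw [hz, Complex.exp_add, Complex.exp_log hu, ← mul_assoc, ← Complex.exp_add]
      congr 2; ring
    rw [e, Complex.log_exp]
    · rw [him]; exact h4.1
    · rw [him]; exact h4.2.le
  refine ⟨key, fun hzz => ?_⟩
  have e : Complex.exp (-(2 * π * Complex.I * θ)) * z = -1 := by
    rw [hzz, mul_neg, ← Complex.exp_add]; simp
  rw [e, Complex.log_neg_one] at key
  have := congrArg Complex.im key
  rw [him] at this
  simp at this
  linarith [h4.2]

theorem aux_spec {A : Type*} [CStarAlgebra A] (a b : A) (ha : a ∈ unitary A)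
    (hb : b ∈ unitary A) (e z : ℂ) (δ : ℝ)
    (h : ‖b * a - e • (a * b)‖ < δ) (hz : z ∈ spectrum ℂ (b * a * star b * star a)) :
    ‖z - e‖ < δ := by
  have hN : Nontrivial A := by
    by_contra hc
    rw [not_nontrivial_iff_subsingleton] at hc
    rw [spectrum.of_subsingleton] at hz
    exact hz
  have h1 : z - e ∈ spectrum ℂ (b * a * star b * star a - algebraMap ℂ A e) := by
    rw [← spectrum.sub_singleton_eq]
    exact ⟨z, hz, e, rfl, rfl⟩
  have h2 := spectrum.norm_le_norm_of_mem h1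
  have h3 : b * a * star b * star a - algebraMap ℂ A e
      = (b * a - e • (a * b)) * (star b * star a) := by
    rw [sub_mul, Algebra.algebraMap_eq_smul_one, smul_mul_assoc]
    have : a * b * (star b * star a) = 1 := by
      rw [mul_assoc, ← mul_assoc b, Unitary.mul_star_self_of_mem hb, one_mul,
        Unitary.mul_star_self_of_mem ha]
    rw [this]; simp only [mul_assoc]
  rw [h3, CStarRing.norm_mul_mem_unitary _
    (mul_mem (Unitary.star_mem hb) (Unitary.star_mem ha))] at h2
  exact h2.trans_lt h

theorem stmt6 (n : ℕ) (hn : 1 ≤ n) (Θ : Fin n → Fin n → ℝ)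
    (hΘ : ∀ j k, Θ j k ∈ Set.Ico (0 : ℝ) 1) :
    ∃ δ > (0 : ℝ), ∃ θ ∈ Set.Ico (0 : ℝ) 1,
      ∀ (A : Type*) [CStarAlgebra A] (v : Fin n → A), (∀ j, v j ∈ unitary A) →
      (∀ j k, ‖v k * v j - Complex.exp (2 * π * Complex.I * (Θ j k)) • (v j * v k)‖ < δ) →
      ∀ j k,
        -Complex.exp (2 * π * Complex.I * θ) ∉
          spectrum ℂ (v k * v j * star (v k) * star (v j)) ∧
        -Complex.exp (2 * π * Complex.I * (Θ j k)) ∉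
          spectrum ℂ (v k * v j * star (v k) * star (v j)) ∧
        logU θ (v k * v j * star (v k) * star (v j)) =
          logU (Θ j k) (v k * v j * star (v k) * star (v j)) := by
  haveI : Nonempty (Fin n) := ⟨⟨0, hn⟩⟩
  obtain ⟨p, hp⟩ := Finite.exists_max (fun p : Fin n × Fin n => Θ p.1 p.2)
  obtain ⟨M, hM⟩ : ∃ M, M = Θ p.1 p.2 := ⟨_, rfl⟩
  have hM0 : 0 ≤ M := hM ▸ (hΘ p.1 p.2).1
  have hM1 : M < 1 := hM ▸ (hΘ p.1 p.2).2
  have hle : ∀ j k, Θ j k ≤ M := fun j k => hM ▸ hp (j, k)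
  have hpi := Real.pi_pos
  have hε : 0 < π * (1 - M) := mul_pos hpi (by linarith)
  have hc : ContinuousAt Complex.log 1 := continuousAt_clog (by simp)
  obtain ⟨δ, hδ, hlog⟩ := Metric.continuousAt_iff.1 hc _ hε
  refine ⟨min δ 1, lt_min hδ one_pos, M / 2, ⟨by linarith, by linarith⟩, ?_⟩
  intro A _ v hv h j k
  have hne : ∀ z ∈ spectrum ℂ (v k * v j * star (v k) * star (v j)),
      ‖z - Complex.exp (2 * π * Complex.I * (Θ j k))‖ < min δ 1 :=
    fun z hz => aux_spec _ _ (hv j) (hv k) _ z _ (h j k) hz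
  have hE : ‖Complex.exp (2 * π * Complex.I * (Θ j k))‖ = 1 := by
    rw [Complex.norm_exp]; simp
  have main : ∀ z ∈ spectrum ℂ (v k * v j * star (v k) * star (v j)), ∀ θ : ℝ,
      |2 * π * (Θ j k - θ)| + π * (1 - M) ≤ π →
      Complex.log (Complex.exp (-(2 * π * Complex.I * θ)) * z)
        = 2 * π * Complex.I * (Θ j k) - 2 * π * Complex.I * θ +
          Complex.log (z / Complex.exp (2 * π * Complex.I * (Θ j k))) ∧
      z ≠ -Complex.exp (2 * π * Complex.I * θ) := by
    intro z hz θ hθ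
    have hE0 := Complex.exp_ne_zero (2 * π * Complex.I * (Θ j k))
    have hd : dist (z / Complex.exp (2 * π * Complex.I * (Θ j k))) 1 < min δ 1 := by
      rw [dist_eq_norm, div_sub_one hE0, norm_div, hE, div_one]
      exact hne z hz
    refine aux_log θ (Θ j k) _ hθ _ z ?_ ?_ ?_
    · intro h0
      rw [h0] at hd
      have := lt_min_iff.1 hd
      simp at this
    · have := hlog (hd.trans_le (min_le_left _ _))
      simpa using this
    · rw [mul_div_cancel₀ _ hE0]
  have hA : |2 * π * (Θ j k - M / 2)| + π * (1 - M) ≤ π := by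
    rw [abs_mul, abs_of_pos (by positivity : 0 < 2 * π)]
    have : |Θ j k - M / 2| ≤ M / 2 :=
      abs_le.2 ⟨by linarith [(hΘ j k).1], by linarith [hle j k]⟩
    nlinarith
  have hB : |2 * π * (Θ j k - Θ j k)| + π * (1 - M) ≤ π := by
    simp; nlinarith
  refine ⟨fun hz => (main _ hz _ hA).2 rfl, fun hz => (main _ hz _ hB).2 rfl, ?_⟩
  unfold logU
  apply cfc_congr
  intro z hz
  have e1 := (main z hz _ hA).1
  have e2 := (main z hz _ hB).1
  simp only
  rw [e1, e2]
  ring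
end
end

section
/- Let θ₁₂, θ₁₃, θ₂₃ be real numbers and let Θ be the real skew-symmetric 3×3 matrix with Θ₁₂ = θ₁₂, Θ₁₃ = θ₁₃, Θ₂₃ = θ₂₃ (and Θ_{k,j} = −Θ_{j,k}, zero diagonal). Then Θ is nondegenerate if and only if the ℚ-vector subspace of ℝ spanned by {1, θ₁₂, θ₁₃, θ₂₃} has dimension at least 3. -/
open scoped Real

noncomputable section

/-- The skew-symmetric `3 × 3` matrix with upper-triangular entries `θ₁₂, θ₁₃, θ₂₃`. -/
def skew3 (θ12 θ13 θ23 : ℝ) : Matrix (Fin 3) (Fin 3) ℝ :=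
  !![0, θ12, θ13; -θ12, 0, θ23; -θ13, -θ23, 0]

/-- Nondegeneracy of a real skew-symmetric `n × n` matrix `Θ`: whenever `x ∈ ℤⁿ` satisfies
`exp(2πi⟨x, Θy⟩) = 1` for all `y ∈ ℤⁿ`, then `x = 0`. -/
def Nondegenerate {n : ℕ} (Θ : Matrix (Fin n) (Fin n) ℝ) : Prop :=
  ∀ x : Fin n → ℤ,
    (∀ y : Fin n → ℤ,
      Complex.exp (2 * π * Complex.I *
        ((∑ i, (x i : ℝ) * Θ.mulVec (fun j => (y j : ℝ)) i : ℝ) : ℂ)) = 1) →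
    x = 0

theorem exp_one_iff (r : ℝ) :
    Complex.exp (2 * π * Complex.I * (r : ℂ)) = 1 ↔ ∃ n : ℤ, r = n := by
  rw [Complex.exp_eq_one_iff]
  have h : (2 * π * Complex.I : ℂ) ≠ 0 := Complex.two_pi_I_ne_zero
  constructor
  · rintro ⟨n, hn⟩
    refine ⟨n, ?_⟩
    rw [mul_comm (n : ℂ)] at hn
    exact_mod_cast mul_left_cancel₀ h hn
  · rintro ⟨n, hn⟩
    refine ⟨n, ?_⟩
    rw [hn, mul_comm]
    push_cast
    rfl

theorem form_eq (a b c : ℝ) (x y : Fin 3 → ℤ) :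
    (∑ i, (x i : ℝ) * (skew3 a b c).mulVec (fun j => (y j : ℝ)) i) =
      y 0 * (-x 1 * a - x 2 * b) + y 1 * (x 0 * a - x 2 * c) + y 2 * (x 0 * b + x 1 * c) := by
  simp [skew3, Matrix.mulVec, dotProduct, Fin.sum_univ_three]
  ring

theorem deg_iff (a b c : ℝ) (x : Fin 3 → ℤ) :
    (∀ y : Fin 3 → ℤ,
      Complex.exp (2 * π * Complex.I *
        ((∑ i, (x i : ℝ) * (skew3 a b c).mulVec (fun j => (y j : ℝ)) i : ℝ) : ℂ)) = 1) ↔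
    (∃ k l m : ℤ, -x 1 * a - x 2 * b = k ∧ x 0 * a - x 2 * c = l ∧ x 0 * b + x 1 * c = m) := by
  simp only [exp_one_iff, form_eq]
  constructor
  · intro h
    obtain ⟨k, hk⟩ := h ![1, 0, 0]
    obtain ⟨l, hl⟩ := h ![0, 1, 0]
    obtain ⟨m, hm⟩ := h ![0, 0, 1]
    simp at hk hl hm
    exact ⟨k, l, m, by linarith, by linarith, by linarith⟩
  · rintro ⟨k, l, m, hk, hl, hm⟩ y
    refine ⟨y 0 * k + y 1 * l + y 2 * m, ?_⟩
    rw [hk, hl, hm]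
    push_cast
    rfl

theorem mem_pair (t v : ℝ) (p q : ℚ) (h : v = p + q * t) :
    v ∈ Submodule.span ℚ ({1, t} : Set ℝ) := by
  rw [Submodule.mem_span_pair]
  exact ⟨p, q, by rw [h]; simp [Rat.smul_def]⟩

theorem finrank_le (t a b c : ℝ) (ha : a ∈ Submodule.span ℚ ({1, t} : Set ℝ))
    (hb : b ∈ Submodule.span ℚ ({1, t} : Set ℝ)) (hc : c ∈ Submodule.span ℚ ({1, t} : Set ℝ)) :
    Module.finrank ℚ (Submodule.span ℚ ({1, a, b, c} : Set ℝ)) ≤ 2 := by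
  have h1 : Submodule.span ℚ ({1, a, b, c} : Set ℝ) ≤ Submodule.span ℚ ({1, t} : Set ℝ) := by
    rw [Submodule.span_le]
    rintro z (rfl | rfl | rfl | rfl)
    · exact Submodule.subset_span (by simp)
    all_goals assumption
  have : Module.Finite ℚ (Submodule.span ℚ ({1, t} : Set ℝ)) :=
    Module.Finite.span_of_finite ℚ (Set.toFinite _)
  refine (Submodule.finrank_mono h1).trans ?_
  have := finrank_span_finset_le_card (R := ℚ) ({1, t} : Finset ℝ)
  simp only [Finset.coe_insert, Finset.coe_singleton] at this
  exact this.trans Finset.card_le_two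

theorem exists_t (a b c : ℝ)
    (h : Module.finrank ℚ (Submodule.span ℚ ({1, a, b, c} : Set ℝ)) ≤ 2) :
    ∃ t : ℝ, ∀ v ∈ ({1, a, b, c} : Set ℝ), ∃ p q : ℚ, v = p + q * t := by
  set V := Submodule.span ℚ ({1, a, b, c} : Set ℝ) with hV
  have fV : Module.Finite ℚ V := Module.Finite.span_of_finite ℚ (Set.toFinite _)
  by_cases hc : ∀ v ∈ V, ∃ p : ℚ, v = p
  · refine ⟨0, fun v hv => ?_⟩
    obtain ⟨p, hp⟩ := hc v (Submodule.subset_span hv)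
    exact ⟨p, 0, by simp [hp]⟩
  · push Not at hc
    obtain ⟨t, ht, hp⟩ := hc
    refine ⟨t, fun v hv => ?_⟩
    have li : LinearIndependent ℚ ![(1 : ℝ), t] := by
      rw [LinearIndependent.pair_iff]
      intro s u hsu
      simp only [Rat.smul_def, mul_one] at hsu
      have hu : u = 0 := by
        by_contra hu
        have hu' : (u : ℝ) ≠ 0 := by exact_mod_cast hu
        apply hp (-s / u)
        push_cast
        field_simp
        linarith
      subst hu
      simp at hsu
      exact ⟨hsu, rfl⟩
    have hr := finrank_span_eq_card li
    have he : Submodule.span ℚ (Set.range ![(1 : ℝ), t]) = V := by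
      apply Submodule.eq_of_le_of_finrank_le
      · rw [Submodule.span_le]
        rintro _ ⟨i, rfl⟩
        fin_cases i
        · exact Submodule.subset_span (by simp)
        · exact ht
      · rw [hr]; simpa using h
    have hv' : v ∈ V := Submodule.subset_span hv
    rw [← he] at hv'
    simp only [Matrix.range_cons, Matrix.range_empty, Set.union_empty, Set.singleton_union] at hv'
    rw [Submodule.mem_span_pair] at hv'
    obtain ⟨p, q, h⟩ := hv'
    exact ⟨p, q, by rw [← h]; simp [Rat.smul_def]⟩

theorem common_den (a b c d e f : ℚ) : ∃ N A B C D E F : ℤ, N ≠ 0 ∧ N * a = A ∧ N * b = B ∧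
    N * c = C ∧ N * d = D ∧ N * e = E ∧ N * f = F := by
  refine ⟨a.den * b.den * c.den * d.den * e.den * f.den,
    a.num * b.den * c.den * d.den * e.den * f.den,
    a.den * b.num * c.den * d.den * e.den * f.den,
    a.den * b.den * c.num * d.den * e.den * f.den,
    a.den * b.den * c.den * d.num * e.den * f.den,
    a.den * b.den * c.den * d.den * e.num * f.den,
    a.den * b.den * c.den * d.den * e.den * f.num, by simp, ?_, ?_, ?_, ?_, ?_, ?_⟩ <;> push_cast
  · rw [← Rat.mul_den_eq_num a]; ring
  · rw [← Rat.mul_den_eq_num b]; ring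
  · rw [← Rat.mul_den_eq_num c]; ring
  · rw [← Rat.mul_den_eq_num d]; ring
  · rw [← Rat.mul_den_eq_num e]; ring
  · rw [← Rat.mul_den_eq_num f]; ring

theorem stmt9 (θ12 θ13 θ23 : ℝ) :
    Nondegenerate (skew3 θ12 θ13 θ23) ↔
      3 ≤ Module.finrank ℚ (Submodule.span ℚ ({1, θ12, θ13, θ23} : Set ℝ)) := by
  simp only [Nondegenerate, deg_iff]
  constructor
  · intro h
    by_contra hlt
    obtain ⟨t, ht⟩ := exists_t θ12 θ13 θ23 (by omega)
    obtain ⟨a, b, h1⟩ := ht θ12 (by simp)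
    obtain ⟨c, d, h2⟩ := ht θ13 (by simp)
    obtain ⟨e, f, h3⟩ := ht θ23 (by simp)
    obtain ⟨N, A, B, C, D, E, F, hN, hA, hB, hC, hD, hE, hF⟩ := common_den a b c d e f
    have hA' : (N * a : ℝ) = A := by exact_mod_cast hA
    have hB' : (N * b : ℝ) = B := by exact_mod_cast hB
    have hC' : (N * c : ℝ) = C := by exact_mod_cast hC
    have hD' : (N * d : ℝ) = D := by exact_mod_cast hD
    have hE' : (N * e : ℝ) = E := by exact_mod_cast hE
    have hF' : (N * f : ℝ) = F := by exact_mod_cast hF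
    have k1 : N * θ12 = A + B * t := by rw [h1, ← hA', ← hB']; ring
    have k2 : N * θ13 = C + D * t := by rw [h2, ← hC', ← hD']; ring
    have k3 : N * θ23 = E + F * t := by rw [h3, ← hE', ← hF']; ring
    by_cases hz : F = 0 ∧ D = 0 ∧ B = 0
    · obtain ⟨rfl, rfl, rfl⟩ := hz
      have := h ![N, 0, 0] ⟨0, A, C, by simp, by simpa using k1, by simpa using k2⟩
      exact hN (by simpa using congrFun this 0)
    · have := h ![N * F, -(N * D), N * B]
        ⟨D * A - B * C, F * A - B * E, F * C - D * E, ?_, ?_, ?_⟩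
      · have q0 := congrFun this 0
        have q1 := congrFun this 1
        have q2 := congrFun this 2
        simp [hN] at q0 q1 q2
        exact hz ⟨q0, q1, q2⟩
      · simp
        linear_combination (D : ℝ) * k1 - B * k2
      · simp
        linear_combination (F : ℝ) * k1 - B * k3
      · simp
        linear_combination (F : ℝ) * k2 - D * k3
  · rintro h x ⟨k, l, m, hk, hl, hm⟩
    by_contra hx
    suffices Module.finrank ℚ (Submodule.span ℚ ({1, θ12, θ13, θ23} : Set ℝ)) ≤ 2 by omega
    by_cases h0 : x 0 = 0
    · by_cases h1 : x 1 = 0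
      · have h2 : x 2 ≠ 0 := by
          intro h2
          apply hx
          ext i
          fin_cases i <;> simpa
        have h2' : (x 2 : ℝ) ≠ 0 := by exact_mod_cast h2
        apply finrank_le θ12
        · exact mem_pair _ _ 0 1 (by simp)
        · refine mem_pair _ _ (-k / x 2) (-x 1 / x 2) ?_
          push_cast; field_simp; linarith
        · refine mem_pair _ _ (-l / x 2) (x 0 / x 2) ?_
          push_cast; field_simp; linarith
      · have h1' : (x 1 : ℝ) ≠ 0 := by exact_mod_cast h1
        apply finrank_le θ13
        · refine mem_pair _ _ (-k / x 1) (-x 2 / x 1) ?_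
          push_cast; field_simp; linarith
        · exact mem_pair _ _ 0 1 (by simp)
        · refine mem_pair _ _ (m / x 1) (-x 0 / x 1) ?_
          push_cast; field_simp; linarith
    · have h0' : (x 0 : ℝ) ≠ 0 := by exact_mod_cast h0
      apply finrank_le θ23
      · refine mem_pair _ _ (l / x 0) (x 2 / x 0) ?_
        push_cast; field_simp; linarith
      · refine mem_pair _ _ (m / x 0) (-x 1 / x 0) ?_
        push_cast; field_simp; linarith
      · exact mem_pair _ _ 0 1 (by simp)
end
end
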